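/- arXiv:math-ph/0305007 — 3 statements merged into one kernel-verified Lean document; each statement's English description precedes it below -/
import Mathlib

section
/- Let V be a 4×4 unitary complex matrix, E a 4×4 invertible real matrix, and Γ^1, Γ^2, Γ^3, Γ^4 complex 4×4 matrices such that V γ^i V⁻¹ = ∑_{μ=1}^{4} E^i_μ Γ^μ for every i ∈ {1,2,3,4}. Define the induced metric g_{μν} := ∑_{i=1}^{4} E^i_μ E^i_ν. Then for each k ∈ {1,2,3,4} and each ν ∈ {1,2,3,4}, ∑_{μ=1}^{4} g_{μν} (V Ψ^(k))† Γ^μ (V Ψ^(k)) = E^k_ν. -/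
open Matrix
open scoped Kronecker

/-- The Pauli matrices `τ₁, τ₂, τ₃` and the 2×2 identity `τ₄`,
indexed by `Fin 4` (so `pauli 0 = τ₁`, ..., `pauli 3 = τ₄ = I₂`). -/
def pauli : Fin 4 → Matrix (Fin 2) (Fin 2) ℂ
  | 0 => !![0, 1; 1, 0]
  | 1 => !![0, -Complex.I; Complex.I, 0]
  | 2 => !![1, 0; 0, -1]
  | 3 => 1

/-- The gamma matrices: `γ^i = τ₁ ⊗ τᵢ` for `i = 1,2,3` and `γ⁴ = τ₂ ⊗ τ₄`,
indexed by `Fin 4` (so `gamma 0 = γ¹`, ..., `gamma 3 = γ⁴`). -/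
def gamma (i : Fin 4) : Matrix (Fin 4) (Fin 4) ℂ :=
  Matrix.reindex finProdFinEquiv finProdFinEquiv
    (if i = 3 then pauli 1 ⊗ₖ pauli 3 else pauli 0 ⊗ₖ pauli i)

/-- The spinors `Ψ^(1) = ½(1,1,1,1)`, `Ψ^(2) = ½(1,i,1,i)`, `Ψ^(3) = (1/√2)(1,0,1,0)`,
`Ψ^(4) = ½(1,1,i,i)`, indexed by `Fin 4`. -/
noncomputable def soSpinor : Fin 4 → Fin 4 → ℂ
  | 0 => (2 : ℂ)⁻¹ • ![1, 1, 1, 1]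
  | 1 => (2 : ℂ)⁻¹ • ![1, Complex.I, 1, Complex.I]
  | 2 => ((Real.sqrt 2 : ℂ))⁻¹ • ![1, 0, 1, 0]
  | 3 => (2 : ℂ)⁻¹ • ![1, 1, Complex.I, Complex.I]

/-- The spinor `Ψ^(k)` has expectation value `δ_{ik}` in the gamma matrix `γ^i`. -/
theorem soSpinor_gamma_expectation (i k : Fin 4) :
    star (soSpinor k) ⬝ᵥ (gamma i).mulVec (soSpinor k) = if i = k then 1 else 0 := by
  have hsqrt : ((Real.sqrt 2 : ℂ))⁻¹ * ((Real.sqrt 2 : ℂ))⁻¹ = 2⁻¹ := by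
    rw [← mul_inv, ← Complex.ofReal_mul, Real.mul_self_sqrt (by norm_num)]
    norm_num
  fin_cases i <;> fin_cases k <;>
    simp [gamma, pauli, soSpinor, dotProduct, mulVec, Fin.sum_univ_four, finProdFinEquiv,
      Fin.divNat, Fin.modNat, Matrix.one_apply, hsqrt, map_ofNat] <;>
    ring_nf <;> norm_num

/-- Expectation values are unchanged when a unitary acts on both the vector and the operator. -/
theorem unitary_conj_expectation {n : Type*} [Fintype n] [DecidableEq n] {V : Matrix n n ℂ}
    (hV : V ∈ Matrix.unitaryGroup n ℂ) (A : Matrix n n ℂ) (ψ : n → ℂ) :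
    star (V.mulVec ψ) ⬝ᵥ (V * A * V⁻¹).mulVec (V.mulVec ψ) = star ψ ⬝ᵥ A.mulVec ψ := by
  have hVV : Vᴴ * V = 1 := Matrix.mem_unitaryGroup_iff'.mp hV
  rw [Matrix.inv_eq_left_inv hVV, star_mulVec, ← dotProduct_mulVec, mulVec_mulVec, mulVec_mulVec,
    Matrix.mul_assoc, Matrix.mul_assoc (V * A), hVV, Matrix.mul_one, ← Matrix.mul_assoc, hVV,
    Matrix.one_mul]

/-- If `V` is unitary, `E` is an invertible real matrix and `V γ^i V⁻¹ = ∑_μ E^i_μ Γ^μ`,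
then, with the induced metric `g_{μν} = ∑_i E^i_μ E^i_ν`, the SO(4)-representation gives
`∑_μ g_{μν} (VΨ^(k))† Γ^μ (VΨ^(k)) = E^k_ν`. -/
theorem stmt4 (V : Matrix (Fin 4) (Fin 4) ℂ) (hV : V ∈ Matrix.unitaryGroup (Fin 4) ℂ)
    (E : Matrix (Fin 4) (Fin 4) ℝ) (hE : IsUnit E.det)
    (Γm : Fin 4 → Matrix (Fin 4) (Fin 4) ℂ)
    (hΓ : ∀ i : Fin 4, V * gamma i * V⁻¹ = ∑ μ : Fin 4, (E i μ : ℂ) • Γm μ)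
    (g : Fin 4 → Fin 4 → ℝ) (hg : ∀ μ ν : Fin 4, g μ ν = ∑ i : Fin 4, E i μ * E i ν) :
    ∀ k ν : Fin 4,
      ∑ μ : Fin 4, (g μ ν : ℂ) *
          (star (V.mulVec (soSpinor k)) ⬝ᵥ (Γm μ).mulVec (V.mulVec (soSpinor k)))
        = (E k ν : ℂ) := by
  intro k ν
  set q : Fin 4 → ℂ := fun μ =>
    star (V.mulVec (soSpinor k)) ⬝ᵥ (Γm μ).mulVec (V.mulVec (soSpinor k)) with hq
  have hframe : ∀ i, ∑ μ, (E i μ : ℂ) * q μ = if i = k then 1 else 0 := by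
    intro i
    rw [← soSpinor_gamma_expectation, ← unitary_conj_expectation hV, hΓ]
    simp only [hq, sum_mulVec, dotProduct_sum, smul_mulVec, dotProduct_smul, smul_eq_mul]
  calc ∑ μ, (g μ ν : ℂ) * q μ = ∑ i, (E i ν : ℂ) * ∑ μ, (E i μ : ℂ) * q μ := by
        simp only [hg, Complex.ofReal_sum, Complex.ofReal_mul, Finset.sum_mul, Finset.mul_sum]
        rw [Finset.sum_comm]
        exact Finset.sum_congr rfl fun i _ => Finset.sum_congr rfl fun μ _ => by ring
    _ = (E k ν : ℂ) := by simp [hframe]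
end

section
/- Let U be a 4×4 unitary complex matrix and R a 4×4 real matrix such that U† γ^i U = ∑_{j=1}^{4} R^i_j γ^j for every i ∈ {1,2,3,4}. Then R is orthogonal, i.e., R Rᵀ = I₄. -/
open Matrix
open scoped Kronecker

/-- The trace of a matrix is invariant under relabelling its indices. -/
theorem trace_submatrix_equiv {m n R : Type*} [Fintype m] [Fintype n] [AddCommMonoid R]
    (e : m ≃ n) (A : Matrix n n R) : (A.submatrix e e).trace = A.trace :=
  Equiv.sum_comp e fun i => A i i

/-- The gamma matrices are orthogonal for the trace form. -/
theorem trace_gamma_mul_gamma (i j : Fin 4) :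
    (gamma i * gamma j).trace = if i = j then 4 else 0 := by
  simp only [gamma, reindex_apply]
  rw [submatrix_mul_equiv, trace_submatrix_equiv]
  fin_cases i <;> fin_cases j <;>
    simp [← mul_kronecker_mul, trace_kronecker, pauli, trace_fin_two] <;> norm_num

/-- The trace form on linear combinations of gamma matrices is four times the dot product. -/
theorem trace_sum_smul_gamma_mul (a b : Fin 4 → ℂ) :
    ((∑ j, a j • gamma j) * ∑ j, b j • gamma j).trace = 4 * (a ⬝ᵥ b) := by
  simp only [Finset.sum_mul_sum, trace_sum, smul_mul_smul_comm, trace_smul,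
    trace_gamma_mul_gamma, smul_eq_mul, mul_ite, mul_zero, Finset.sum_ite_eq, Finset.mem_univ,
    if_true, dotProduct, ← Finset.sum_mul, mul_comm]

/-- Conjugation by a unitary matrix preserves the trace of a product. -/
theorem trace_conj_mul_conj {n : Type*} [Fintype n] [DecidableEq n] {U : Matrix n n ℂ}
    (hU : U ∈ Matrix.unitaryGroup n ℂ) (A B : Matrix n n ℂ) :
    ((Uᴴ * A * U) * (Uᴴ * B * U)).trace = (A * B).trace := by
  have hU' : U * Uᴴ = 1 := mem_unitaryGroup_iff.mp hU
  calc ((Uᴴ * A * U) * (Uᴴ * B * U)).trace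
      = (Uᴴ * (A * (U * Uᴴ) * B * U)).trace := by simp only [Matrix.mul_assoc]
    _ = (A * B * (U * Uᴴ)).trace := by
      rw [trace_mul_comm, hU', Matrix.mul_one, Matrix.mul_assoc, hU']
    _ = (A * B).trace := by rw [hU', Matrix.mul_one]

/-- If `U` is unitary and `U† γ^i U = ∑_j R^i_j γ^j` with `R` a real matrix,
then `R` is orthogonal: `R Rᵀ = I₄`. -/
theorem stmt5 (U : Matrix (Fin 4) (Fin 4) ℂ) (hU : U ∈ Matrix.unitaryGroup (Fin 4) ℂ)
    (R : Matrix (Fin 4) (Fin 4) ℝ)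
    (hR : ∀ i : Fin 4, Uᴴ * gamma i * U = ∑ j : Fin 4, (R i j : ℂ) • gamma j) :
    R * Rᵀ = 1 := by
  ext i k
  have h := trace_conj_mul_conj hU (gamma i) (gamma k)
  rw [hR, hR, trace_sum_smul_gamma_mul, trace_gamma_mul_gamma] at h
  have h4 : ((4 * (R * Rᵀ) i k : ℝ) : ℂ) = ((if i = k then 4 else 0 : ℝ) : ℂ) := by
    simpa [mul_apply, dotProduct, apply_ite Complex.ofReal] using h
  have h5 := Complex.ofReal_injective h4
  rw [one_apply]
  split_ifs at h5 ⊢ <;> linarith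
end

section
/- Under the same hypotheses, for each (s,q) define the 2×2 real matrices G_S(s) := (g_{αβ}(s)), G(s,q) := (⟨∂X/∂s^α, ∂X/∂s^β⟩), and A(s,q) with entries A^γ_β := ∑_{α̇ ∈ {3,4}} q^{α̇} Γ^γ_{α̇β}. Then G = (I₂ + A)ᵀ G_S (I₂ + A), and consequently det G = (det(I₂ + A))² · det G_S; in particular det G = ρ · det G_S where ρ := (1 + ∑_{α̇} q^{α̇} Γ^α_{α̇α} + det A)² (sum over α ∈ {1,2} in the trace term). -/
open Matrix

/-- The partial derivative of `p s + q 0 • e 0 s + q 1 • e 1 s` in a direction tangent to the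
first factor. -/
theorem fderiv_normal_translate {E F : Type*} [NormedAddCommGroup E] [NormedSpace ℝ E]
    [NormedAddCommGroup F] [NormedSpace ℝ F] {p : E → F} {e : Fin 2 → E → F}
    {X : E × (Fin 2 → ℝ) → F} (hp : Differentiable ℝ p) (he : ∀ a, Differentiable ℝ (e a))
    (hX : ∀ s q, X (s, q) = p s + q 0 • e 0 s + q 1 • e 1 s) (s : E) (q : Fin 2 → ℝ) (v : E) :
    fderiv ℝ X (s, q) (v, 0)
      = fderiv ℝ p s v + q 0 • fderiv ℝ (e 0) s v + q 1 • fderiv ℝ (e 1) s v := by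
  have hXd : Differentiable ℝ X := by
    have hX_eq : X = fun z => p z.1 + z.2 0 • e 0 z.1 + z.2 1 • e 1 z.1 :=
      funext fun z => hX z.1 z.2
    have := he 0
    have := he 1
    rw [hX_eq]
    fun_prop
  have hslice : HasFDerivAt (fun s' => X (s', q))
      ((fderiv ℝ X (s, q)).comp (ContinuousLinearMap.inl ℝ E (Fin 2 → ℝ))) s :=
    (hXd (s, q)).hasFDerivAt.comp s (hasFDerivAt_prodMk_left s q)
  have hsum : HasFDerivAt (fun s' => X (s', q))
      (fderiv ℝ p s + q 0 • fderiv ℝ (e 0) s + q 1 • fderiv ℝ (e 1) s) s := by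
    simp only [hX]
    exact ((hp s).hasFDerivAt.add ((he 0 s).hasFDerivAt.const_smul (q 0))).add
      ((he 1 s).hasFDerivAt.const_smul (q 1))
  simpa using congrArg (fun L => L v) (hslice.unique hsum)

/-- For a `2 × 2` matrix, `det (1 + M) = 1 + tr M + det M`. -/
theorem Matrix.det_one_add_fin_two {R : Type*} [CommRing R] (M : Matrix (Fin 2) (Fin 2) R) :
    (1 + M).det = 1 + M.trace + M.det := by
  simp [Matrix.det_fin_two, Matrix.trace_fin_two]
  ring

/-- Under the tubular-neighborhood hypotheses, the tangential block `G` of the induced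
metric satisfies `G = (I₂ + A)ᵀ G_S (I₂ + A)` where `A^γ_β = ∑_α̇ q^α̇ Γ^γ_{α̇β}`; hence
`det G = (det(I₂ + A))² det G_S = ρ · det G_S` with
`ρ = (1 + ∑_α̇ q^α̇ Γ^α_{α̇α} + det A)²`. -/
theorem stmt12 (p : (Fin 2 → ℝ) → (Fin 4 → ℝ)) (hp : ContDiff ℝ (⊤ : ℕ∞) p)
    (e : Fin 2 → (Fin 2 → ℝ) → (Fin 4 → ℝ)) (he : ∀ αd : Fin 2, ContDiff ℝ (⊤ : ℕ∞) (e αd))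
    (hortho : ∀ (αd βd : Fin 2) (s : Fin 2 → ℝ),
      e αd s ⬝ᵥ e βd s = if αd = βd then 1 else 0)
    (htang : ∀ (αd β : Fin 2) (s : Fin 2 → ℝ),
      e αd s ⬝ᵥ fderiv ℝ p s (Pi.single β 1) = 0)
    (Γ : Fin 2 → Fin 2 → Fin 2 → (Fin 2 → ℝ) → ℝ)
    (hΓs : ∀ β αd α : Fin 2, ContDiff ℝ (⊤ : ℕ∞) (Γ β αd α))
    (hΓ : ∀ (αd α : Fin 2) (s : Fin 2 → ℝ),
      fderiv ℝ (e αd) s (Pi.single α 1)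
        = ∑ β : Fin 2, Γ β αd α s • fderiv ℝ p s (Pi.single β 1))
    (X : (Fin 2 → ℝ) × (Fin 2 → ℝ) → (Fin 4 → ℝ))
    (hX : ∀ (s q : Fin 2 → ℝ), X (s, q) = p s + q 0 • e 0 s + q 1 • e 1 s)
    (GS : (Fin 2 → ℝ) → Matrix (Fin 2) (Fin 2) ℝ)
    (hGS : ∀ (s : Fin 2 → ℝ) (α β : Fin 2),
      GS s α β = fderiv ℝ p s (Pi.single α 1) ⬝ᵥ fderiv ℝ p s (Pi.single β 1))
    (G : (Fin 2 → ℝ) → (Fin 2 → ℝ) → Matrix (Fin 2) (Fin 2) ℝ)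
    (hG : ∀ (s q : Fin 2 → ℝ) (α β : Fin 2),
      G s q α β
        = fderiv ℝ X (s, q) (Pi.single α 1, 0) ⬝ᵥ fderiv ℝ X (s, q) (Pi.single β 1, 0))
    (A : (Fin 2 → ℝ) → (Fin 2 → ℝ) → Matrix (Fin 2) (Fin 2) ℝ)
    (hA : ∀ (s q : Fin 2 → ℝ) (γ β : Fin 2),
      A s q γ β = ∑ αd : Fin 2, q αd * Γ γ αd β s) :
    ∀ s q : Fin 2 → ℝ,
      (G s q = (1 + A s q)ᵀ * GS s * (1 + A s q)) ∧
      ((G s q).det = (1 + A s q).det ^ 2 * (GS s).det) ∧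
      ((G s q).det
        = (1 + (∑ αd : Fin 2, q αd * ∑ α : Fin 2, Γ α αd α s) + (A s q).det) ^ 2
            * (GS s).det) := by
  intro s q
  let P : Matrix (Fin 2) (Fin 4) ℝ := Matrix.of fun β => fderiv ℝ p s (Pi.single β 1)
  have hGSP : GS s = P * Pᵀ := by
    ext α β
    exact hGS s α β
  let D : Matrix (Fin 2) (Fin 4) ℝ := (1 + A s q)ᵀ * P
  have hdX (α : Fin 2) : fderiv ℝ X (s, q) (Pi.single α 1, 0) = D α := by
    rw [fderiv_normal_translate (hp.differentiable (by simp))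
      (fun a => (he a).differentiable (by simp)) hX, hΓ, hΓ]
    ext i
    fin_cases α <;>
      simp [Matrix.mul_apply, Fin.sum_univ_two, hA, P, D] <;> ring
  have hG_eq : G s q = (1 + A s q)ᵀ * GS s * (1 + A s q) := by
    have hGD : G s q = D * Dᵀ := by
      ext α β
      rw [hG, hdX, hdX]
      rfl
    rw [hGD, hGSP, show D = (1 + A s q)ᵀ * P from rfl, Matrix.transpose_mul,
      Matrix.transpose_transpose]
    simp only [Matrix.mul_assoc]
  have hdet : (G s q).det = (1 + A s q).det ^ 2 * (GS s).det := by
    rw [hG_eq, Matrix.det_mul, Matrix.det_mul, Matrix.det_transpose]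
    ring
  have htrace : (A s q).trace = ∑ αd : Fin 2, q αd * ∑ α : Fin 2, Γ α αd α s := by
    simp only [Matrix.trace_fin_two, hA, Fin.sum_univ_two]
    ring
  exact ⟨hG_eq, hdet, by rw [hdet, Matrix.det_one_add_fin_two, htrace]⟩
end
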